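/- arXiv:1608.04810 — 4 statements merged into one kernel-verified Lean document; each statement's English description precedes it below -/
import Mathlib

section
/- Assume λ < ε = Λ. Let σ be a 2-plane in V with unit normal vector u = c₁e₁ + c₂e₂ + c₃e₃. Then sec(σ) = ε if and only if c₂ = 0. -/
open scoped RealInnerProductSpace

/-- An algebraic curvature tensor on a real inner product space: a quadrilinear map
satisfying the symmetries of a Riemann curvature tensor and the first Bianchi identity. -/
structure IsAlgCurvatureTensor {V : Type*} [NormedAddCommGroup V] [InnerProductSpace ℝ V]
    (R : V →ₗ[ℝ] V →ₗ[ℝ] V →ₗ[ℝ] V →ₗ[ℝ] ℝ) : Prop where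
  antisym_fst : ∀ X Y Z W : V, R X Y Z W = - R Y X Z W
  antisym_snd : ∀ X Y Z W : V, R X Y Z W = - R X Y W Z
  pair_symm : ∀ X Y Z W : V, R X Y Z W = R Z W X Y
  bianchi : ∀ X Y Z W : V, R X Y Z W + R Y Z X W + R Z X Y W = 0


/-- In an orthonormal frame diagonalizing the Ricci tensor, the curvature of `X ∧ Y` is the
diagonal quadratic form in the coordinates of the cross product of `X` and `Y`. -/
theorem IsAlgCurvatureTensor.apply_eq_of_diagonal
    {V : Type*} [NormedAddCommGroup V] [InnerProductSpace ℝ V]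
    {R : V →ₗ[ℝ] V →ₗ[ℝ] V →ₗ[ℝ] V →ₗ[ℝ] ℝ} (hR : IsAlgCurvatureTensor R) {a b c : V}
    (h₁ : R a b c a = 0) (h₂ : R a b b c = 0) (h₃ : R a c c b = 0) (x y : Fin 3 → ℝ) :
    R (x 0 • a + x 1 • b + x 2 • c) (y 0 • a + y 1 • b + y 2 • c)
        (y 0 • a + y 1 • b + y 2 • c) (x 0 • a + x 1 • b + x 2 • c) =
      R a b b a * (x 0 * y 1 - x 1 * y 0) ^ 2 + R a c c a * (x 0 * y 2 - x 2 * y 0) ^ 2 +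
        R b c c b * (x 1 * y 2 - x 2 * y 1) ^ 2 := by
  have self_fst (P Z W : V) : R P P Z W = 0 := by linarith [hR.antisym_fst P P Z W]
  have self_snd (P Z W : V) : R Z W P P = 0 := by linarith [hR.antisym_snd Z W P P]
  have ba := hR.antisym_fst b a
  have ca := hR.antisym_fst c a
  have cb := hR.antisym_fst c b
  have ab' (Z W : V) := hR.antisym_snd Z W a b
  have ac' (Z W : V) := hR.antisym_snd Z W a c
  have bc' (Z W : V) := hR.antisym_snd Z W b c
  have h₁' : R a c b a = 0 := by
    rw [hR.pair_symm, ba, ac', h₁]; simp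
  have h₂' : R b c b a = 0 := by
    rw [hR.pair_symm, ba, h₂]; simp
  have h₂'' : R a b c b = 0 := by linarith [bc' a b]
  have h₃' : R b c c a = 0 := by
    rw [hR.pair_symm, ca, bc', h₃]; simp
  simp only [map_add, map_smul, LinearMap.add_apply, LinearMap.smul_apply, smul_eq_mul,
    self_fst, self_snd, ba, ca, cb, ab', ac', bc', h₁, h₁', h₂'', h₂', h₃, h₃']
  ring

/-- The squared second coordinate of the cross product of the first two members of an orthonormal
triple in `ℝ³` is that of the third member. -/
theorem sq_cross_eq_of_orthonormal {x y c : Fin 3 → ℝ}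
    (h : !![x 0, x 1, x 2; y 0, y 1, y 2; c 0, c 1, c 2] *
      (!![x 0, x 1, x 2; y 0, y 1, y 2; c 0, c 1, c 2]).transpose = 1) :
    (x 0 * y 2 - x 2 * y 0) ^ 2 = c 1 ^ 2 := by
  have h' := mul_eq_one_comm.mp h
  have h00 := congrFun₂ h' 0 0
  have h02 := congrFun₂ h' 0 2
  have h22 := congrFun₂ h' 2 2
  have hcc := congrFun₂ h 2 2
  simp [Matrix.mul_apply, Fin.sum_univ_three] at h00 h02 h22 hcc
  have e00 : x 0 * x 0 + y 0 * y 0 = 1 - c 0 * c 0 := by linarith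
  have e22 : x 2 * x 2 + y 2 * y 2 = 1 - c 2 * c 2 := by linarith
  have e02 : x 0 * x 2 + y 0 * y 2 = - (c 0 * c 2) := by linarith
  calc (x 0 * y 2 - x 2 * y 0) ^ 2
      = (x 0 * x 0 + y 0 * y 0) * (x 2 * x 2 + y 2 * y 2)
        - (x 0 * x 2 + y 0 * y 2) ^ 2 := by ring
    _ = c 1 ^ 2 := by rw [e00, e22, e02]; linarith

/-- In the case `λ < ε = Λ`, a 2-plane `σ` with unit normal `u = c₁e₁ + c₂e₂ + c₃e₃`
has `sec(σ) = ε` if and only if `c₂ = 0`. -/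
theorem sec_eq_eps_iff_extremal_plus
    {V : Type*} [NormedAddCommGroup V] [InnerProductSpace ℝ V]
    (hdim : Module.finrank ℝ V = 3)
    (R : V →ₗ[ℝ] V →ₗ[ℝ] V →ₗ[ℝ] V →ₗ[ℝ] ℝ) (hR : IsAlgCurvatureTensor R)
    (e : Fin 3 → V) (he : Orthonormal ℝ e)
    (ε : ℝ) (hε : ε = -1 ∨ ε = 0 ∨ ε = 1)
    (hd1 : R (e 0) (e 1) (e 2) (e 0) = 0)
    (hd2 : R (e 0) (e 1) (e 1) (e 2) = 0)
    (hd3 : R (e 0) (e 2) (e 2) (e 1) = 0)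
    (lam Lam : ℝ)
    (hlam : lam = R (e 0) (e 2) (e 2) (e 0))
    (hLam : Lam = R (e 1) (e 2) (e 2) (e 1))
    (h12 : R (e 0) (e 1) (e 1) (e 0) = ε)
    (horder : lam ≤ ε ∧ ε ≤ Lam)
    (hcase : lam < ε ∧ ε = Lam)
    (c₁ c₂ c₃ : ℝ) (u X Y : V)
    (hu : u = c₁ • e 0 + c₂ • e 1 + c₃ • e 2) (hunorm : ‖u‖ = 1)
    (hXnorm : ‖X‖ = 1) (hYnorm : ‖Y‖ = 1) (hXY : ⟪X, Y⟫ = 0)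
    (hXu : ⟪X, u⟫ = 0) (hYu : ⟪Y, u⟫ = 0)
    :
    R X Y Y X = ε ↔ c₂ = 0 := by
  have : FiniteDimensional ℝ V := Module.finite_of_finrank_pos (by omega)
  have hspan : ⊤ ≤ Submodule.span ℝ (Set.range e) :=
    (he.linearIndependent.span_eq_top_of_card_eq_finrank' (by simp [hdim])).ge
  let b : OrthonormalBasis (Fin 3) ℝ V := OrthonormalBasis.mk he hspan
  have hb : ⇑b = e := OrthonormalBasis.coe_mk he hspan
  have expand (Z : V) : Z = b.repr Z 0 • e 0 + b.repr Z 1 • e 1 + b.repr Z 2 • e 2 := by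
    have := b.sum_repr Z
    rw [Fin.sum_univ_three, hb] at this
    exact this.symm
  have inner_eq (Z W : V) : ⟪Z, W⟫ =
      b.repr Z 0 * b.repr W 0 + b.repr Z 1 * b.repr W 1 + b.repr Z 2 * b.repr W 2 := by
    rw [← b.repr.inner_map_map, PiLp.inner_apply, Fin.sum_univ_three]
    simp [mul_comm]
  have repr_e (i j : Fin 3) : b.repr (e i) j = if j = i then 1 else 0 := by
    rw [← hb, b.repr_self]; simp
  have hc₂ : b.repr u 1 = c₂ := by simp [hu, repr_e]
  have hXX : ⟪X, X⟫ = 1 := by rw [real_inner_self_eq_norm_sq, hXnorm, one_pow]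
  have hYY : ⟪Y, Y⟫ = 1 := by rw [real_inner_self_eq_norm_sq, hYnorm, one_pow]
  have huu : ⟪u, u⟫ = 1 := by rw [real_inner_self_eq_norm_sq, hunorm, one_pow]
  rw [inner_eq] at hXX hYY huu hXY hXu hYu
  have hcross := sq_cross_eq_of_orthonormal
    (x := b.repr X) (y := b.repr Y) (c := b.repr u) (by
      ext i j
      fin_cases i <;> fin_cases j <;> simp [Matrix.mul_apply, Fin.sum_univ_three] <;> linarith)
  have hsec := hR.apply_eq_of_diagonal hd1 hd2 hd3 (b.repr X) (b.repr Y)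
  rw [← expand X, ← expand Y, h12, ← hlam, ← hLam, ← hcase.2] at hsec
  have lagrange : R X Y Y X = ε + (lam - ε) * c₂ ^ 2 := by
    rw [hsec, ← hc₂, ← hcross]
    linear_combination ε * ((b.repr Y 0 * b.repr Y 0 + b.repr Y 1 * b.repr Y 1
      + b.repr Y 2 * b.repr Y 2) * hXX + hYY
      - (b.repr X 0 * b.repr Y 0 + b.repr X 1 * b.repr Y 1 + b.repr X 2 * b.repr Y 2) * hXY)
  rw [lagrange, add_eq_left, mul_eq_zero, sub_eq_zero, pow_eq_zero_iff two_ne_zero]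
  exact or_iff_right hcase.1.ne
end

section
/- Let X = (x₁, x₂, x₃) ∈ V be a unit vector with x₃ = 0 and x₂ ≠ ±m·x₁, and let W be a unit vector orthogonal to X. Then V⁺ = V⁻ or V⁺ = −V⁻, and R(X, W, W, X) = ε if and only if W = V⁺ or W = −V⁺. -/
open scoped RealInnerProductSpace

/-- The sectional curvature expression `R(X, W, W, X)` for `X` in the plane of `e 0, e 1`, when the
tensor is diagonal in the frame `e`. -/
theorem IsAlgCurvatureTensor.apply_of_diagonal
    {V : Type*} [NormedAddCommGroup V] [InnerProductSpace ℝ V]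
    {R : V →ₗ[ℝ] V →ₗ[ℝ] V →ₗ[ℝ] V →ₗ[ℝ] ℝ} (hR : IsAlgCurvatureTensor R) (e : Fin 3 → V)
    (hd1 : R (e 0) (e 1) (e 2) (e 0) = 0)
    (hd2 : R (e 0) (e 1) (e 1) (e 2) = 0)
    (hd3 : R (e 0) (e 2) (e 2) (e 1) = 0) (x₁ x₂ a b c : ℝ) :
    R (x₁ • e 0 + x₂ • e 1) (a • e 0 + b • e 1 + c • e 2) (a • e 0 + b • e 1 + c • e 2)
        (x₁ • e 0 + x₂ • e 1) =
      (x₁ * b - x₂ * a) ^ 2 * R (e 0) (e 1) (e 1) (e 0) +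
        c ^ 2 * (x₁ ^ 2 * R (e 0) (e 2) (e 2) (e 0) + x₂ ^ 2 * R (e 1) (e 2) (e 2) (e 1)) := by
  have self_fst (Y Z W : V) : R Y Y Z W = 0 := by linarith [hR.antisym_fst Y Y Z W]
  have self_snd (X Y Z : V) : R X Y Z Z = 0 := by linarith [hR.antisym_snd X Y Z Z]
  have swap_fst (Z W : V) : R (e 1) (e 0) Z W = - R (e 0) (e 1) Z W := hR.antisym_fst ..
  have swap_snd (X Y : V) : R X Y (e 0) (e 1) = - R X Y (e 1) (e 0) := hR.antisym_snd ..
  have h0210 : R (e 0) (e 2) (e 1) (e 0) = 0 := by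
    linarith [hR.pair_symm (e 0) (e 2) (e 1) (e 0), hR.antisym_fst (e 1) (e 0) (e 0) (e 2),
      hR.antisym_snd (e 0) (e 1) (e 0) (e 2)]
  have h0121 : R (e 0) (e 1) (e 2) (e 1) = 0 := by
    linarith [hR.antisym_snd (e 0) (e 1) (e 2) (e 1)]
  have h1210 : R (e 1) (e 2) (e 1) (e 0) = 0 := by
    linarith [hR.pair_symm (e 1) (e 2) (e 1) (e 0), hR.antisym_fst (e 1) (e 0) (e 1) (e 2)]
  have h1220 : R (e 1) (e 2) (e 2) (e 0) = 0 := by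
    linarith [hR.pair_symm (e 1) (e 2) (e 2) (e 0), hR.antisym_fst (e 2) (e 0) (e 1) (e 2),
      hR.antisym_snd (e 0) (e 2) (e 1) (e 2)]
  simp only [map_add, map_smul, LinearMap.add_apply, LinearMap.smul_apply, smul_eq_mul,
    self_fst, self_snd, swap_fst, swap_snd, hd1, hd3, h0210, h0121, h1210, h1220]
  ring

/-- An orthonormal triple in a three-dimensional space gives coordinates. -/
theorem Orthonormal.exists_coords_of_finrank_eq_three
    {V : Type*} [NormedAddCommGroup V] [InnerProductSpace ℝ V]
    (hdim : Module.finrank ℝ V = 3) {e : Fin 3 → V} (he : Orthonormal ℝ e) (W : V) :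
    ∃ a b c : ℝ, W = a • e 0 + b • e 1 + c • e 2 := by
  have hspan := he.linearIndependent.span_eq_top_of_card_eq_finrank (by simp [hdim])
  have hW : W ∈ Submodule.span ℝ (Set.range e) := hspan ▸ Submodule.mem_top
  obtain ⟨w, rfl⟩ := (Submodule.mem_span_range_iff_exists_fun ℝ).1 hW
  exact ⟨w 0, w 1, w 2, Fin.sum_univ_three _⟩

theorem Orthonormal.inner_coords_fin_three
    {V : Type*} [NormedAddCommGroup V] [InnerProductSpace ℝ V]
    {e : Fin 3 → V} (he : Orthonormal ℝ e) (a b c a' b' c' : ℝ) :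
    ⟪a • e 0 + b • e 1 + c • e 2, a' • e 0 + b' • e 1 + c' • e 2⟫ =
      a * a' + b * b' + c * c' := by
  have h := he.inner_sum ![a, b, c] ![a', b', c'] Finset.univ
  simpa [Fin.sum_univ_three] using h

theorem one_div_abs_smul_smul_eq_or
    {V : Type*} [AddCommGroup V] [Module ℝ V] {t : ℝ} (ht : t ≠ 0) (U : V) :
    (1 / |t|) • t • U = U ∨ (1 / |t|) • t • U = -U := by
  rcases abs_choice t with h | h
  · left
    rw [h, smul_smul, one_div_mul_cancel ht, one_smul]
  · right
    rw [h, smul_smul, one_div_neg_eq_neg_one_div, neg_mul, one_div_mul_cancel ht, neg_one_smul]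

/-- For a unicurved unit vector `X = (x₁, x₂, 0)` (with `x₂ ≠ ±m·x₁`) in the generic case,
`V⁺ = ±V⁻`, and a unit vector `W ⊥ X` spans a curvature-`ε` plane with `X`
if and only if `W = ±V⁺`. -/
theorem curvature_eps_planes_unicurved
    {V : Type*} [NormedAddCommGroup V] [InnerProductSpace ℝ V]
    (hdim : Module.finrank ℝ V = 3)
    (R : V →ₗ[ℝ] V →ₗ[ℝ] V →ₗ[ℝ] V →ₗ[ℝ] ℝ) (hR : IsAlgCurvatureTensor R)
    (e : Fin 3 → V) (he : Orthonormal ℝ e)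
    (ε : ℝ) (hε : ε = -1 ∨ ε = 0 ∨ ε = 1)
    (hd1 : R (e 0) (e 1) (e 2) (e 0) = 0)
    (hd2 : R (e 0) (e 1) (e 1) (e 2) = 0)
    (hd3 : R (e 0) (e 2) (e 2) (e 1) = 0)
    (lam Lam : ℝ)
    (hlam : lam = R (e 0) (e 2) (e 2) (e 0))
    (hLam : Lam = R (e 1) (e 2) (e 2) (e 1))
    (h12 : R (e 0) (e 1) (e 1) (e 0) = ε)
    (horder : lam ≤ ε ∧ ε ≤ Lam)
    (hgen : lam < ε ∧ ε < Lam)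
    (m : ℝ) (hm : m = Real.sqrt ((ε - lam) / (Lam - ε)))
    (x₁ x₂ x₃ : ℝ) (X : V)
    (hX : X = x₁ • e 0 + x₂ • e 1 + x₃ • e 2) (hXnorm : ‖X‖ = 1)
    (hx₃ : x₃ = 0) (hx₂ : x₂ ≠ m * x₁) (hx₂' : x₂ ≠ -(m * x₁))
    (K L : ℝ)
    (hK : K = Real.sqrt (1 + m ^ 2 - (m * x₂ - x₁) ^ 2))
    (hL : L = Real.sqrt (1 + m ^ 2 - (m * x₂ + x₁) ^ 2))
    (Vp Vm : V)
    (hVp : Vp = (1 / K) • ((1 + m * x₁ * x₂ - x₁ ^ 2) • e 0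
      + (m * x₂ ^ 2 - x₁ * x₂ - m) • e 1 + ((m * x₂ - x₁) * x₃) • e 2))
    (hVm : Vm = (1 / L) • ((1 - m * x₁ * x₂ - x₁ ^ 2) • e 0
      + (-(m * x₂ ^ 2) - x₁ * x₂ + m) • e 1 + ((-(m * x₂) - x₁) * x₃) • e 2))
    (W : V) (hWnorm : ‖W‖ = 1) (hWX : ⟪X, W⟫ = 0) :
    (Vp = Vm ∨ Vp = -Vm) ∧ (R X W W X = ε ↔ (W = Vp ∨ W = -Vp)) := by
  subst hx₃
  have hxx : x₁ ^ 2 + x₂ ^ 2 = 1 := by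
    have h := real_inner_self_eq_norm_sq X
    rw [hXnorm, hX, he.inner_coords_fin_three] at h
    linarith
  -- `V⁺` and `V⁻` are both unit multiples of the rotation `U` of `X` in the plane of `e 0, e 1`.
  set U : V := x₂ • e 0 + (-x₁) • e 1 with hU
  have hK' : K = |x₂ + m * x₁| := by
    rw [hK, ← Real.sqrt_sq_eq_abs]
    congr 1
    linear_combination (-(1 + m ^ 2)) * hxx
  have hL' : L = |x₂ - m * x₁| := by
    rw [hL, ← Real.sqrt_sq_eq_abs]
    congr 1
    linear_combination (-(1 + m ^ 2)) * hxx
  have hp : x₂ + m * x₁ ≠ 0 := fun h => hx₂' (by linarith)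
  have hq : x₂ - m * x₁ ≠ 0 := fun h => hx₂ (by linarith)
  have hVp' : Vp = U ∨ Vp = -U := by
    have h : Vp = (1 / |x₂ + m * x₁|) • (x₂ + m * x₁) • U := by
      rw [hVp, hK', hU]
      congr 1
      match_scalars
      · linear_combination (-1) * hxx
      · linear_combination m * hxx
      · ring
    rw [h]
    exact one_div_abs_smul_smul_eq_or hp U
  have hVm' : Vm = U ∨ Vm = -U := by
    have h : Vm = (1 / |x₂ - m * x₁|) • (x₂ - m * x₁) • U := by
      rw [hVm, hL', hU]
      congr 1
      match_scalars
      · linear_combination (-1) * hxx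
      · linear_combination (-m) * hxx
      · ring
    rw [h]
    exact one_div_abs_smul_smul_eq_or hq U
  have hWU : (W = Vp ∨ W = -Vp) ↔ (W = U ∨ W = -U) := by
    rcases hVp' with h | h <;> rw [h]
    rw [neg_neg, or_comm]
  refine ⟨?_, ?_⟩
  · rcases hVp' with h | h <;> rcases hVm' with h' | h' <;> simp [h, h']
  rw [hWU]
  obtain ⟨a, b, c, hW⟩ := he.exists_coords_of_finrank_eq_three hdim W
  have hww : a ^ 2 + b ^ 2 + c ^ 2 = 1 := by
    have h := real_inner_self_eq_norm_sq W
    rw [hWnorm, hW, he.inner_coords_fin_three] at h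
    linarith
  have hxw : x₁ * a + x₂ * b = 0 := by
    rw [hX, hW, he.inner_coords_fin_three] at hWX
    linarith
  have hm2 : m ^ 2 * (Lam - ε) = ε - lam := by
    have hpos : 0 < Lam - ε := by linarith [hgen.2]
    rw [hm, Real.sq_sqrt (div_nonneg (by linarith [hgen.1]) hpos.le), div_mul_cancel₀ _ hpos.ne']
  have hsec : R X W W X - ε = c ^ 2 * ((Lam - ε) * ((x₂ + m * x₁) * (x₂ - m * x₁))) := by
    have hX' : X = x₁ • e 0 + x₂ • e 1 := by rw [hX, zero_smul, add_zero]
    rw [hX', hW, hR.apply_of_diagonal e hd1 hd2 hd3, h12, ← hlam, ← hLam]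
    linear_combination (-(x₁ * a + x₂ * b) * ε) * hxw + (a ^ 2 + b ^ 2) * ε * hxx + ε * hww +
      c ^ 2 * x₁ ^ 2 * hm2 + c ^ 2 * ε * hxx
  have hc : R X W W X = ε ↔ c = 0 := by
    rw [← sub_eq_zero, hsec]
    simp [sub_eq_zero.not.2 hgen.2.ne', hp, hq]
  rw [hc]
  constructor
  · rintro rfl
    have hrot : (x₂ * a - x₁ * b) ^ 2 = 1 := by
      linear_combination (a ^ 2 + b ^ 2) * hxx + hww - (x₁ * a + x₂ * b) * hxw
    have hWrot : W = (x₂ * a - x₁ * b) • U := by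
      rw [hW, hU]
      match_scalars
      · linear_combination x₁ * hxw - a * hxx
      · linear_combination x₂ * hxw - b * hxx
      · ring
    rcases sq_eq_sq_iff_eq_or_eq_neg.1 (hrot.trans (one_pow 2).symm) with h | h <;> simp [hWrot, h]
  · intro h
    have hWc : ⟪(0 : ℝ) • e 0 + (0 : ℝ) • e 1 + (1 : ℝ) • e 2, W⟫ = c := by
      rw [hW, he.inner_coords_fin_three]
      ring
    have hUc : ⟪(0 : ℝ) • e 0 + (0 : ℝ) • e 1 + (1 : ℝ) • e 2, U⟫ = 0 := by
      have h := he.inner_coords_fin_three 0 0 1 x₂ (-x₁) 0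
      rw [zero_smul ℝ (e 2), add_zero] at h
      simpa [hU] using h
    rcases h with h | h
    · rw [← hWc, h, hUc]
    · rw [← hWc, h, inner_neg_right, hUc, neg_zero]
end

section
/- Let X = (x₁, x₂, x₃) ∈ V be a unit vector. If x₃ = 0 and x₂ ≠ ±m·x₁, then there is exactly one 2-plane of V containing X with sectional curvature ε (X is unicurved). If x₃ ≠ 0, then there are exactly two 2-planes of V containing X with sectional curvature ε. -/
open scoped RealInnerProductSpace

/-- `σ` is a 2-plane of `V` containing `X` whose sectional curvature equals `ε`
(the sectional curvature of `σ` is `R(A,B,B,A)` for any orthonormal basis `{A, B}` of `σ`). -/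
def IsCurvEpsPlaneThrough {V : Type*} [NormedAddCommGroup V] [InnerProductSpace ℝ V]
    (R : V →ₗ[ℝ] V →ₗ[ℝ] V →ₗ[ℝ] V →ₗ[ℝ] ℝ) (ε : ℝ) (X : V) (σ : Submodule ℝ V) : Prop :=
  Module.finrank ℝ σ = 2 ∧ X ∈ σ ∧
    ∀ A B : V, A ∈ σ → B ∈ σ → ‖A‖ = 1 → ‖B‖ = 1 → ⟪A, B⟫ = 0 → R A B B A = ε

section AlgCurvatureTensor

variable {V : Type*} [NormedAddCommGroup V] [InnerProductSpace ℝ V]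

lemma Orthonormal.inner_fin_three {e : Fin 3 → V} (he : Orthonormal ℝ e) (a b : Fin 3 → ℝ) :
    ⟪∑ i, a i • e i, ∑ i, b i • e i⟫ = a 0 * b 0 + a 1 * b 1 + a 2 * b 2 := by
  rw [he.inner_sum]
  simp [Fin.sum_univ_three]

lemma Orthonormal.exists_eq_sum_of_finrank_eq_three (hdim : Module.finrank ℝ V = 3)
    {e : Fin 3 → V} (he : Orthonormal ℝ e) (A : V) : ∃ a : Fin 3 → ℝ, A = ∑ i, a i • e i := by
  let b := basisOfLinearIndependentOfCardEqFinrank he.linearIndependent (by simp [hdim])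
  refine ⟨b.repr A, ?_⟩
  have h := b.sum_repr A
  simp only [b, coe_basisOfLinearIndependentOfCardEqFinrank] at h
  exact h.symm

lemma Orthonormal.sum_smul_injective {e : Fin 3 → V} (he : Orthonormal ℝ e) {a b : Fin 3 → ℝ}
    (h : ∑ i, a i • e i = ∑ i, b i • e i) : a = b := by
  have := Fintype.linearIndependent_iff.1 he.linearIndependent (a - b)
    (by simp [sub_smul, Finset.sum_sub_distrib, h])
  funext i
  simpa [sub_eq_zero] using this i

namespace IsAlgCurvatureTensor

variable {R : V →ₗ[ℝ] V →ₗ[ℝ] V →ₗ[ℝ] V →ₗ[ℝ] ℝ}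

/-- In dimension three the curvature tensor depends on its first two arguments only through
their cross product. -/
lemma apply_sum_sum (hR : IsAlgCurvatureTensor R) (e : Fin 3 → V) (a b : Fin 3 → ℝ) (Z W : V) :
    R (∑ i, a i • e i) (∑ i, b i • e i) Z W =
      (a 1 * b 2 - a 2 * b 1) * R (e 1) (e 2) Z W + (a 0 * b 2 - a 2 * b 0) * R (e 0) (e 2) Z W +
        (a 0 * b 1 - a 1 * b 0) * R (e 0) (e 1) Z W := by
  have hself (Y : V) : R Y Y Z W = 0 := by linarith [hR.antisym_fst Y Y Z W]
  have h10 := hR.antisym_fst (e 1) (e 0) Z W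
  have h20 := hR.antisym_fst (e 2) (e 0) Z W
  have h21 := hR.antisym_fst (e 2) (e 1) Z W
  simp only [Fin.sum_univ_three, map_add, map_smul, LinearMap.add_apply, LinearMap.smul_apply,
    smul_eq_mul, hself, h10, h20, h21]
  ring

/-- The biquadratic form of a curvature tensor in a basis diagonalizing the Ricci tensor. -/
lemma apply_sum_sum_sum_sum (hR : IsAlgCurvatureTensor R) {e : Fin 3 → V}
    (hd1 : R (e 0) (e 1) (e 2) (e 0) = 0) (hd2 : R (e 0) (e 1) (e 1) (e 2) = 0)
    (hd3 : R (e 0) (e 2) (e 2) (e 1) = 0) (a b : Fin 3 → ℝ) :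
    R (∑ i, a i • e i) (∑ i, b i • e i) (∑ i, b i • e i) (∑ i, a i • e i) =
      (a 1 * b 2 - a 2 * b 1) ^ 2 * R (e 1) (e 2) (e 2) (e 1) +
        (a 0 * b 2 - a 2 * b 0) ^ 2 * R (e 0) (e 2) (e 2) (e 0) +
        (a 0 * b 1 - a 1 * b 0) ^ 2 * R (e 0) (e 1) (e 1) (e 0) := by
  have hsnd (Z W : V) : R Z W (∑ i, b i • e i) (∑ i, a i • e i) =
      -(R (∑ i, a i • e i) (∑ i, b i • e i) Z W) := by
    rw [hR.antisym_snd, hR.pair_symm Z W]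
  rw [hR.apply_sum_sum]
  simp only [hsnd, hR.apply_sum_sum]
  have h1 := hR.antisym_snd (e 0) (e 1) (e 2) (e 0)
  have h2 := hR.antisym_snd (e 0) (e 2) (e 2) (e 1)
  have h3 := hR.pair_symm (e 1) (e 2) (e 0) (e 2)
  have h4 := hR.pair_symm (e 1) (e 2) (e 0) (e 1)
  have h5 := hR.pair_symm (e 0) (e 2) (e 0) (e 1)
  have h6 := hR.antisym_snd (e 0) (e 2) (e 2) (e 0)
  have h7 := hR.antisym_snd (e 1) (e 2) (e 2) (e 1)
  have h8 := hR.antisym_snd (e 0) (e 1) (e 1) (e 0)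
  have g1 : R (e 0) (e 1) (e 0) (e 2) = 0 := by linarith
  have g2 : R (e 0) (e 2) (e 1) (e 2) = 0 := by linarith
  rw [h3, h4, h5, h6, h7, h8, g1, g2, hd2]
  ring

end IsAlgCurvatureTensor

/-- The plane through `X` and the vector `e₀ + s e₁`. -/
def planeWithSlope (e : Fin 3 → V) (X : V) (s : ℝ) : Submodule ℝ V :=
  Submodule.span ℝ {X, e 0 + s • e 1}

/-- The curvature excess of an orthonormal pair `A, B` is a product of the determinants of
`A, B` with the vectors `e₀ ± m e₁`. -/
lemma IsAlgCurvatureTensor.sec_sub_eq_mul {R : V →ₗ[ℝ] V →ₗ[ℝ] V →ₗ[ℝ] V →ₗ[ℝ] ℝ}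
    (hR : IsAlgCurvatureTensor R) {e : Fin 3 → V} (he : Orthonormal ℝ e)
    (hd1 : R (e 0) (e 1) (e 2) (e 0) = 0) (hd2 : R (e 0) (e 1) (e 1) (e 2) = 0)
    (hd3 : R (e 0) (e 2) (e 2) (e 1) = 0) {ε m : ℝ} (h12 : R (e 0) (e 1) (e 1) (e 0) = ε)
    (hm : m ^ 2 * (R (e 1) (e 2) (e 2) (e 1) - ε) = ε - R (e 0) (e 2) (e 2) (e 0))
    {a b : Fin 3 → ℝ} (hA : ‖∑ i, a i • e i‖ = 1) (hB : ‖∑ i, b i • e i‖ = 1)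
    (hAB : ⟪∑ i, a i • e i, ∑ i, b i • e i⟫ = 0) :
    R (∑ i, a i • e i) (∑ i, b i • e i) (∑ i, b i • e i) (∑ i, a i • e i) - ε =
      (R (e 1) (e 2) (e 2) (e 1) - ε) *
        (((a 1 * b 2 - a 2 * b 1) - m * (a 0 * b 2 - a 2 * b 0)) *
          ((a 1 * b 2 - a 2 * b 1) - -m * (a 0 * b 2 - a 2 * b 0))) := by
  have haa := real_inner_self_eq_norm_sq (∑ i, a i • e i)
  have hbb := real_inner_self_eq_norm_sq (∑ i, b i • e i)
  rw [he.inner_fin_three] at haa hbb hAB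
  rw [hA] at haa
  rw [hB] at hbb
  rw [hR.apply_sum_sum_sum_sum hd1 hd2 hd3, h12]
  linear_combination (a 0 * b 2 - a 2 * b 0) ^ 2 * hm
    + ε * (b 0 * b 0 + b 1 * b 1 + b 2 * b 2) * haa
    + ε * hbb - ε * (a 0 * b 0 + a 1 * b 1 + a 2 * b 2) * hAB

/-- A vector whose determinant with an orthonormal pair vanishes lies in the span of the pair. -/
lemma Orthonormal.eq_smul_add_smul_of_det_eq_zero {e : Fin 3 → V} (he : Orthonormal ℝ e)
    {a b w : Fin 3 → ℝ} (hA : ‖∑ i, a i • e i‖ = 1) (hB : ‖∑ i, b i • e i‖ = 1)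
    (hAB : ⟪∑ i, a i • e i, ∑ i, b i • e i⟫ = 0)
    (hdet : w 0 * (a 1 * b 2 - a 2 * b 1) - w 1 * (a 0 * b 2 - a 2 * b 0) +
      w 2 * (a 0 * b 1 - a 1 * b 0) = 0) :
    ∃ p q : ℝ, ∑ i, w i • e i = p • ∑ i, a i • e i + q • ∑ i, b i • e i := by
  have haa := real_inner_self_eq_norm_sq (∑ i, a i • e i)
  have hbb := real_inner_self_eq_norm_sq (∑ i, b i • e i)
  rw [he.inner_fin_three] at haa hbb hAB
  rw [hA] at haa
  rw [hB] at hbb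
  set p := a 0 * w 0 + a 1 * w 1 + a 2 * w 2 with hp
  set q := b 0 * w 0 + b 1 * w 1 + b 2 * w 2 with hq
  refine ⟨p, q, ?_⟩
  have hsum : ∑ i, w i • e i - (p • ∑ i, a i • e i + q • ∑ i, b i • e i) =
      ∑ i, (w i - p * a i - q * b i) • e i := by
    simp only [Finset.smul_sum, smul_smul, sub_smul, Finset.sum_sub_distrib]
    abel
  rw [← sub_eq_zero, hsum, ← inner_self_eq_zero (𝕜 := ℝ), he.inner_fin_three, hp, hq]
  linear_combination (w 0 * (a 1 * b 2 - a 2 * b 1) - w 1 * (a 0 * b 2 - a 2 * b 0) +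
      w 2 * (a 0 * b 1 - a 1 * b 0)) * hdet +
    ((a 0 * w 0 + a 1 * w 1 + a 2 * w 2) ^ 2 + (b 0 * w 0 + b 1 * w 1 + b 2 * w 2) ^ 2) *
      (haa + hbb) +
    (w 0 ^ 2 + w 1 ^ 2 + w 2 ^ 2) * ((a 0 * b 0 + a 1 * b 1 + a 2 * b 2) * hAB -
      (b 0 * b 0 + b 1 * b 1 + b 2 * b 2) * haa - hbb)

lemma sum_slope_smul (e : Fin 3 → V) (s : ℝ) :
    ∑ i, (![1, s, 0] : Fin 3 → ℝ) i • e i = e 0 + s • e 1 := by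
  simp [Fin.sum_univ_three]

lemma smul_sum_add_smul_slope (e : Fin 3 → V) (x : Fin 3 → ℝ) (s p q : ℝ) :
    p • ∑ i, x i • e i + q • (e 0 + s • e 1) =
      ∑ i, (p * x i + q * (![1, s, 0] : Fin 3 → ℝ) i) • e i := by
  rw [← sum_slope_smul]
  simp only [Finset.smul_sum, smul_smul, add_smul, Finset.sum_add_distrib]

lemma mem_planeWithSlope_iff {e : Fin 3 → V} (he : Orthonormal ℝ e) {x a : Fin 3 → ℝ} {s : ℝ} :
    ∑ i, a i • e i ∈ planeWithSlope e (∑ i, x i • e i) s ↔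
      ∃ p q : ℝ, a 0 = p * x 0 + q ∧ a 1 = p * x 1 + q * s ∧ a 2 = p * x 2 := by
  simp only [planeWithSlope, Submodule.mem_span_pair, smul_sum_add_smul_slope]
  refine exists₂_congr fun p q => ⟨fun h => ?_, fun ⟨h0, h1, h2⟩ => ?_⟩
  · have h' := he.sum_smul_injective h
    refine ⟨?_, ?_, ?_⟩ <;> simp [← h']
  · simp [Fin.sum_univ_three, h0, h1, h2]

lemma finrank_planeWithSlope {e : Fin 3 → V} (he : Orthonormal ℝ e) {x : Fin 3 → ℝ} {s : ℝ}
    (hx : x 2 ≠ 0 ∨ x 1 ≠ s * x 0) :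
    Module.finrank ℝ (planeWithSlope e (∑ i, x i • e i) s) = 2 := by
  have hli : LinearIndependent ℝ ![∑ i, x i • e i, e 0 + s • e 1] := by
    refine LinearIndependent.pair_iff.2 fun p q h => ?_
    rw [smul_sum_add_smul_slope] at h
    have h' := Fintype.linearIndependent_iff.1 he.linearIndependent _ h
    have h0 : p * x 0 + q = 0 := by simpa using h' 0
    have h1 : p * x 1 + q * s = 0 := by simpa using h' 1
    have h2 : p * x 2 = 0 := by simpa using h' 2
    have hp : p = 0 := by
      rcases hx with hx | hx
      · exact (mul_eq_zero.1 h2).resolve_right hx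
      · have : p * (x 1 - s * x 0) = 0 := by linear_combination h1 - s * h0
        exact (mul_eq_zero.1 this).resolve_right (sub_ne_zero.2 hx)
    exact ⟨hp, by simpa [hp] using h0⟩
  rw [planeWithSlope, ← Matrix.range_cons_cons_empty _ _ ![], finrank_span_eq_card hli,
    Fintype.card_fin]

lemma planeWithSlope_eq_of_mem {e : Fin 3 → V} (he : Orthonormal ℝ e) {x : Fin 3 → ℝ} {s : ℝ}
    (hx : x 2 ≠ 0 ∨ x 1 ≠ s * x 0) {σ : Submodule ℝ V} (hσ : Module.finrank ℝ σ = 2)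
    (hX : ∑ i, x i • e i ∈ σ) (hs : e 0 + s • e 1 ∈ σ) :
    σ = planeWithSlope e (∑ i, x i • e i) s := by
  have : FiniteDimensional ℝ σ := Module.finite_of_finrank_pos (by omega)
  refine (Submodule.eq_of_le_of_finrank_eq (Submodule.span_le.2 ?_) ?_).symm
  · rintro _ (rfl | rfl)
    exacts [hX, hs]
  · rw [hσ]
    exact finrank_planeWithSlope he hx

section GenericTensor

variable {R : V →ₗ[ℝ] V →ₗ[ℝ] V →ₗ[ℝ] V →ₗ[ℝ] ℝ}

lemma IsAlgCurvatureTensor.isCurvEpsPlaneThrough_planeWithSlope (hR : IsAlgCurvatureTensor R)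
    (hdim : Module.finrank ℝ V = 3) {e : Fin 3 → V} (he : Orthonormal ℝ e)
    (hd1 : R (e 0) (e 1) (e 2) (e 0) = 0) (hd2 : R (e 0) (e 1) (e 1) (e 2) = 0)
    (hd3 : R (e 0) (e 2) (e 2) (e 1) = 0) {ε s : ℝ} (h12 : R (e 0) (e 1) (e 1) (e 0) = ε)
    (hs : s ^ 2 * (R (e 1) (e 2) (e 2) (e 1) - ε) = ε - R (e 0) (e 2) (e 2) (e 0))
    {x : Fin 3 → ℝ} (hx : x 2 ≠ 0 ∨ x 1 ≠ s * x 0) :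
    IsCurvEpsPlaneThrough R ε (∑ i, x i • e i) (planeWithSlope e (∑ i, x i • e i) s) := by
  refine ⟨finrank_planeWithSlope he hx, Submodule.subset_span (by simp), ?_⟩
  intro A B hAσ hBσ hA hB hAB
  obtain ⟨a, rfl⟩ := he.exists_eq_sum_of_finrank_eq_three hdim A
  obtain ⟨b, rfl⟩ := he.exists_eq_sum_of_finrank_eq_three hdim B
  obtain ⟨p, q, ha0, ha1, ha2⟩ := (mem_planeWithSlope_iff he).1 hAσ
  obtain ⟨p', q', hb0, hb1, hb2⟩ := (mem_planeWithSlope_iff he).1 hBσ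
  rw [← sub_eq_zero, hR.sec_sub_eq_mul he hd1 hd2 hd3 h12 hs hA hB hAB, ha0, ha1, ha2, hb0, hb1,
    hb2]
  ring

lemma IsAlgCurvatureTensor.eq_planeWithSlope (hR : IsAlgCurvatureTensor R)
    (hdim : Module.finrank ℝ V = 3) {e : Fin 3 → V} (he : Orthonormal ℝ e)
    (hd1 : R (e 0) (e 1) (e 2) (e 0) = 0) (hd2 : R (e 0) (e 1) (e 1) (e 2) = 0)
    (hd3 : R (e 0) (e 2) (e 2) (e 1) = 0) {ε m : ℝ} (h12 : R (e 0) (e 1) (e 1) (e 0) = ε)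
    (hm : m ^ 2 * (R (e 1) (e 2) (e 2) (e 1) - ε) = ε - R (e 0) (e 2) (e 2) (e 0))
    (hne : R (e 1) (e 2) (e 2) (e 1) ≠ ε) {x : Fin 3 → ℝ}
    (hx : x 2 ≠ 0 ∨ x 1 ≠ m * x 0) (hx' : x 2 ≠ 0 ∨ x 1 ≠ -m * x 0) {σ : Submodule ℝ V}
    (hσ : IsCurvEpsPlaneThrough R ε (∑ i, x i • e i) σ) :
    σ = planeWithSlope e (∑ i, x i • e i) m ∨ σ = planeWithSlope e (∑ i, x i • e i) (-m) := by
  obtain ⟨hrank, hX, hsec⟩ := hσ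
  have : FiniteDimensional ℝ σ := Module.finite_of_finrank_pos (by omega)
  let b := (stdOrthonormalBasis ℝ σ).reindex (finCongr hrank)
  have hA : ‖(b 0 : V)‖ = 1 := b.orthonormal.1 0
  have hB : ‖(b 1 : V)‖ = 1 := b.orthonormal.1 1
  have hAB : ⟪(b 0 : V), (b 1 : V)⟫ = 0 := b.orthonormal.2 (by decide)
  have hAσ := (b 0).2
  have hBσ := (b 1).2
  generalize (b 0 : V) = A at *
  generalize (b 1 : V) = B at *
  have hcurv := hsec A B hAσ hBσ hA hB hAB
  obtain ⟨u, rfl⟩ := he.exists_eq_sum_of_finrank_eq_three hdim A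
  obtain ⟨v, rfl⟩ := he.exists_eq_sum_of_finrank_eq_three hdim B
  have hmem {s : ℝ} (h : (u 1 * v 2 - u 2 * v 1) - s * (u 0 * v 2 - u 2 * v 0) = 0) :
      e 0 + s • e 1 ∈ σ := by
    obtain ⟨p, q, hpq⟩ := he.eq_smul_add_smul_of_det_eq_zero (w := ![1, s, 0]) hA hB hAB
      (by simpa using h)
    rw [← sum_slope_smul, hpq]
    exact σ.add_mem (σ.smul_mem p hAσ) (σ.smul_mem q hBσ)
  rw [← sub_eq_zero, hR.sec_sub_eq_mul he hd1 hd2 hd3 h12 hm hA hB hAB] at hcurv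
  rcases mul_eq_zero.1 ((mul_eq_zero.1 hcurv).resolve_left (sub_ne_zero.2 hne)) with h | h
  · exact .inl (planeWithSlope_eq_of_mem he hx hrank hX (hmem h))
  · exact .inr (planeWithSlope_eq_of_mem he hx' hrank hX (hmem h))

end GenericTensor

end AlgCurvatureTensor

/-- In the generic case, a unit vector `X = (x₁, x₂, 0)` with `x₂ ≠ ±m·x₁` lies in exactly
one curvature-`ε` 2-plane, and a unit vector `X = (x₁, x₂, x₃)` with `x₃ ≠ 0` lies in
exactly two curvature-`ε` 2-planes. -/
theorem unicurved_and_generic_plane_count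
    {V : Type*} [NormedAddCommGroup V] [InnerProductSpace ℝ V]
    (hdim : Module.finrank ℝ V = 3)
    (R : V →ₗ[ℝ] V →ₗ[ℝ] V →ₗ[ℝ] V →ₗ[ℝ] ℝ) (hR : IsAlgCurvatureTensor R)
    (e : Fin 3 → V) (he : Orthonormal ℝ e)
    (ε : ℝ) (hε : ε = -1 ∨ ε = 0 ∨ ε = 1)
    (hd1 : R (e 0) (e 1) (e 2) (e 0) = 0)
    (hd2 : R (e 0) (e 1) (e 1) (e 2) = 0)
    (hd3 : R (e 0) (e 2) (e 2) (e 1) = 0)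
    (lam Lam : ℝ)
    (hlam : lam = R (e 0) (e 2) (e 2) (e 0))
    (hLam : Lam = R (e 1) (e 2) (e 2) (e 1))
    (h12 : R (e 0) (e 1) (e 1) (e 0) = ε)
    (horder : lam ≤ ε ∧ ε ≤ Lam)
    (hgen : lam < ε ∧ ε < Lam)
    (m : ℝ) (hm : m = Real.sqrt ((ε - lam) / (Lam - ε)))
    (x₁ x₂ x₃ : ℝ) (X : V)
    (hX : X = x₁ • e 0 + x₂ • e 1 + x₃ • e 2) (hXnorm : ‖X‖ = 1) :
    (x₃ = 0 → x₂ ≠ m * x₁ → x₂ ≠ -(m * x₁) →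
      ∃! σ : Submodule ℝ V, IsCurvEpsPlaneThrough R ε X σ) ∧
    (x₃ ≠ 0 →
      ∃ σ₁ σ₂ : Submodule ℝ V, σ₁ ≠ σ₂ ∧
        IsCurvEpsPlaneThrough R ε X σ₁ ∧ IsCurvEpsPlaneThrough R ε X σ₂ ∧
        ∀ σ : Submodule ℝ V, IsCurvEpsPlaneThrough R ε X σ → σ = σ₁ ∨ σ = σ₂) := by
  obtain ⟨hlt, hLt⟩ := hgen
  have hLpos : 0 < Lam - ε := sub_pos.2 hLt
  have hdiv : 0 < (ε - lam) / (Lam - ε) := div_pos (sub_pos.2 hlt) hLpos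
  have hmpos : 0 < m := hm ▸ Real.sqrt_pos.2 hdiv
  have hmsq : m ^ 2 * (Lam - ε) = ε - lam := by
    rw [hm, Real.sq_sqrt hdiv.le, div_mul_cancel₀ _ hLpos.ne']
  rw [hlam, hLam] at hmsq
  have hmsq' := hmsq
  rw [← neg_sq] at hmsq'
  have hne : R (e 1) (e 2) (e 2) (e 1) ≠ ε := hLam ▸ hLt.ne'
  have hXsum : X = ∑ i, (![x₁, x₂, x₃] : Fin 3 → ℝ) i • e i := by
    simp [hX, Fin.sum_univ_three]
  rw [hXsum]
  have hplane {s : ℝ} := hR.isCurvEpsPlaneThrough_planeWithSlope (s := s)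
    (x := ![x₁, x₂, x₃]) hdim he hd1 hd2 hd3 h12
  have honly {σ : Submodule ℝ V} := hR.eq_planeWithSlope (x := ![x₁, x₂, x₃]) (σ := σ)
    hdim he hd1 hd2 hd3 h12 hmsq hne
  constructor
  · rintro rfl hx hx'
    have hxm : (![x₁, x₂, 0] : Fin 3 → ℝ) 2 ≠ 0 ∨
        (![x₁, x₂, 0] : Fin 3 → ℝ) 1 ≠ m * (![x₁, x₂, 0] : Fin 3 → ℝ) 0 := .inr hx
    have hxm' : (![x₁, x₂, 0] : Fin 3 → ℝ) 2 ≠ 0 ∨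
        (![x₁, x₂, 0] : Fin 3 → ℝ) 1 ≠ -m * (![x₁, x₂, 0] : Fin 3 → ℝ) 0 :=
      .inr (by simpa using hx')
    refine ⟨_, hplane hmsq hxm, fun σ hσ => ?_⟩
    rcases honly hxm hxm' hσ with h | h
    · exact h
    · rw [h]
      refine (planeWithSlope_eq_of_mem he hxm' (finrank_planeWithSlope he hxm)
        (Submodule.subset_span (by simp)) ?_).symm
      have hx0 : x₂ - m * x₁ ≠ 0 := sub_ne_zero.2 hx
      rw [← sum_slope_smul, mem_planeWithSlope_iff he]
      refine ⟨-2 * m / (x₂ - m * x₁), 1 + 2 * m / (x₂ - m * x₁) * x₁, ?_, ?_, ?_⟩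
      · simp
        ring
      · simp
        field_simp
        ring
      · simp
  · intro hx
    have hxs (s : ℝ) : (![x₁, x₂, x₃] : Fin 3 → ℝ) 2 ≠ 0 ∨
        (![x₁, x₂, x₃] : Fin 3 → ℝ) 1 ≠ s * (![x₁, x₂, x₃] : Fin 3 → ℝ) 0 := .inl hx
    refine ⟨_, _, fun heq => ?_, hplane hmsq (hxs m), hplane hmsq' (hxs (-m)),
      fun σ => honly (hxs m) (hxs (-m))⟩
    have hmem : ∑ i, (![1, -m, 0] : Fin 3 → ℝ) i • e i ∈
        planeWithSlope e (∑ i, (![x₁, x₂, x₃] : Fin 3 → ℝ) i • e i) m := by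
      rw [heq, sum_slope_smul]
      exact Submodule.subset_span (by simp)
    obtain ⟨p, q, h0, h1, h2⟩ := (mem_planeWithSlope_iff he).1 hmem
    have hp : p = 0 := by simpa [hx] using h2
    have hq : q = 1 := by simpa [hp] using h0.symm
    have : -m = m := by simpa [hp, hq] using h1
    linarith
end

section
/- Assume λ = ε < Λ. Let X = (x₁, x₂, x₃) ∈ V be a unit vector with x₁ ≠ ±1, and let W be a unit vector orthogonal to X. Then R(X, W, W, X) = ε if and only if W = ±((1−x₁²)/√(1−x₁²), −x₁x₂/√(1−x₁²), −x₁x₃/√(1−x₁²)) in coordinates with respect to {e₁, e₂, e₃}. -/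
open scoped RealInnerProductSpace

/-- A bilinear alternating expression in two vectors of a three-dimensional span is
determined by the three Plücker coordinates of the pair. -/
lemma IsAlgCurvatureTensor.expand_fst_pair {V : Type*} [NormedAddCommGroup V]
    [InnerProductSpace ℝ V] {R : V →ₗ[ℝ] V →ₗ[ℝ] V →ₗ[ℝ] V →ₗ[ℝ] ℝ}
    (hR : IsAlgCurvatureTensor R) (e : Fin 3 → V) (x₁ x₂ x₃ w₁ w₂ w₃ : ℝ) (Y Z : V) :
    R (x₁ • e 0 + x₂ • e 1 + x₃ • e 2) (w₁ • e 0 + w₂ • e 1 + w₃ • e 2) Y Z =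
      (x₁ * w₂ - x₂ * w₁) * R (e 0) (e 1) Y Z + (x₁ * w₃ - x₃ * w₁) * R (e 0) (e 2) Y Z
        + (x₂ * w₃ - x₃ * w₂) * R (e 1) (e 2) Y Z := by
  have diag (i : Fin 3) : R (e i) (e i) Y Z = 0 := by
    linarith [hR.antisym_fst (e i) (e i) Y Z]
  simp only [map_add, map_smul, LinearMap.add_apply, LinearMap.smul_apply, smul_eq_mul, diag,
    hR.antisym_fst (e 1) (e 0) Y Z, hR.antisym_fst (e 2) (e 0) Y Z,
    hR.antisym_fst (e 2) (e 1) Y Z]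
  ring

/-- In a frame diagonalizing the curvature, `R X W W X` is a diagonal quadratic form in the
Plücker coordinates of `(X, W)`. -/
lemma IsAlgCurvatureTensor.apply_eq_of_diagonal_s10 {V : Type*} [NormedAddCommGroup V]
    [InnerProductSpace ℝ V] {R : V →ₗ[ℝ] V →ₗ[ℝ] V →ₗ[ℝ] V →ₗ[ℝ] ℝ}
    (hR : IsAlgCurvatureTensor R) (e : Fin 3 → V)
    (hd1 : R (e 0) (e 1) (e 2) (e 0) = 0)
    (hd2 : R (e 0) (e 1) (e 1) (e 2) = 0)
    (hd3 : R (e 0) (e 2) (e 2) (e 1) = 0) (x₁ x₂ x₃ w₁ w₂ w₃ : ℝ) {X W : V}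
    (hX : X = x₁ • e 0 + x₂ • e 1 + x₃ • e 2) (hW : W = w₁ • e 0 + w₂ • e 1 + w₃ • e 2) :
    R X W W X = (x₁ * w₂ - x₂ * w₁) ^ 2 * R (e 0) (e 1) (e 1) (e 0)
      + (x₁ * w₃ - x₃ * w₁) ^ 2 * R (e 0) (e 2) (e 2) (e 0)
      + (x₂ * w₃ - x₃ * w₂) ^ 2 * R (e 1) (e 2) (e 2) (e 1) := by
  have expand_snd (Y Z : V) : R Y Z W X =
      -((x₁ * w₂ - x₂ * w₁) * R (e 0) (e 1) Y Z + (x₁ * w₃ - x₃ * w₁) * R (e 0) (e 2) Y Z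
        + (x₂ * w₃ - x₃ * w₂) * R (e 1) (e 2) Y Z) := by
    rw [hR.antisym_snd, hR.pair_symm, hX, hW, hR.expand_fst_pair]
  have h0102 : R (e 0) (e 1) (e 0) (e 2) = 0 := by rw [hR.antisym_snd, hd1, neg_zero]
  have h0201 : R (e 0) (e 2) (e 0) (e 1) = 0 := by rw [hR.pair_symm, h0102]
  have h1201 : R (e 1) (e 2) (e 0) (e 1) = 0 := by rw [hR.pair_symm, hd2]
  have h0212 : R (e 0) (e 2) (e 1) (e 2) = 0 := by rw [hR.antisym_snd, hd3, neg_zero]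
  have h1202 : R (e 1) (e 2) (e 0) (e 2) = 0 := by rw [hR.pair_symm, h0212]
  have h : R X W W X = (x₁ * w₂ - x₂ * w₁) * R (e 0) (e 1) W X
      + (x₁ * w₃ - x₃ * w₁) * R (e 0) (e 2) W X
      + (x₂ * w₃ - x₃ * w₂) * R (e 1) (e 2) W X := by
    conv_lhs => rw [hX, hW]
    rw [hR.expand_fst_pair, ← hX, ← hW]
  rw [h, expand_snd, expand_snd, expand_snd, h0102, h0201, h1201, hd2, h0212, h1202,
    hR.antisym_snd (e 0) (e 1) (e 1) (e 0), hR.antisym_snd (e 0) (e 2) (e 2) (e 0),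
    hR.antisym_snd (e 1) (e 2) (e 2) (e 1)]
  ring

lemma Orthonormal.inner_fin_three_s10 {V : Type*} [NormedAddCommGroup V] [InnerProductSpace ℝ V]
    {e : Fin 3 → V} (he : Orthonormal ℝ e) (x₁ x₂ x₃ w₁ w₂ w₃ : ℝ) :
    ⟪x₁ • e 0 + x₂ • e 1 + x₃ • e 2, w₁ • e 0 + w₂ • e 1 + w₃ • e 2⟫ =
      x₁ * w₁ + x₂ * w₂ + x₃ * w₃ := by
  simpa [Fin.sum_univ_three] using he.inner_sum ![x₁, x₂, x₃] ![w₁, w₂, w₃] Finset.univ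

lemma Orthonormal.exists_coords_fin_three {V : Type*} [NormedAddCommGroup V]
    [InnerProductSpace ℝ V] {e : Fin 3 → V} (he : Orthonormal ℝ e)
    (hdim : Module.finrank ℝ V = 3) (W : V) :
    ∃ w₁ w₂ w₃ : ℝ, W = w₁ • e 0 + w₂ • e 1 + w₃ • e 2 := by
  let b := basisOfLinearIndependentOfCardEqFinrank he.linearIndependent (by simp [hdim])
  refine ⟨b.repr W 0, b.repr W 1, b.repr W 2, ?_⟩
  have h := b.sum_repr W
  rw [Fin.sum_univ_three] at h
  simpa [b] using h.symm

/-- If `x, w` are orthonormal in `ℝ³` and `(w₂, w₃)` is parallel to `(x₂, x₃) ≠ 0`, then `w` is,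
up to sign, the normalized projection of the first basis vector to the complement of `x`. -/
lemma eq_or_eq_neg_of_parallel {x₁ x₂ x₃ w₁ w₂ w₃ s : ℝ} (hs : s ≠ 0) (hs2 : s ^ 2 = 1 - x₁ ^ 2)
    (hx : x₁ ^ 2 + x₂ ^ 2 + x₃ ^ 2 = 1) (hw : w₁ ^ 2 + w₂ ^ 2 + w₃ ^ 2 = 1)
    (hxw : x₁ * w₁ + x₂ * w₂ + x₃ * w₃ = 0) (hpar : x₂ * w₃ - x₃ * w₂ = 0) :
    (w₁ = (1 - x₁ ^ 2) / s ∧ w₂ = -(x₁ * x₂) / s ∧ w₃ = -(x₁ * x₃) / s) ∨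
    (w₁ = -((1 - x₁ ^ 2) / s) ∧ w₂ = -(-(x₁ * x₂) / s) ∧ w₃ = -(-(x₁ * x₃) / s)) := by
  have h2 : s ^ 2 * w₂ = -(x₁ * x₂) * w₁ := by
    linear_combination w₂ * hs2 - w₂ * hx + x₂ * hxw - x₃ * hpar
  have h3 : s ^ 2 * w₃ = -(x₁ * x₃) * w₁ := by
    linear_combination w₃ * hs2 - w₃ * hx + x₃ * hxw + x₂ * hpar
  have h1 : w₁ ^ 2 = s ^ 2 := by
    have hyz : x₂ ^ 2 + x₃ ^ 2 = s ^ 2 := by linarith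
    linear_combination (w₂ ^ 2 + w₃ ^ 2) * hyz + s ^ 2 * hw - w₁ ^ 2 * hs2
      - (x₂ * w₂ + x₃ * w₃ - x₁ * w₁) * hxw - (x₂ * w₃ - x₃ * w₂) * hpar
  rw [← hs2]
  rcases sq_eq_sq_iff_eq_or_eq_neg.mp h1 with rfl | rfl
  · refine Or.inl ⟨by field_simp, ?_, ?_⟩ <;> rw [eq_div_iff hs] <;> apply mul_left_cancel₀ hs
    · linear_combination h2
    · linear_combination h3
  · refine Or.inr ⟨by field_simp, ?_, ?_⟩ <;> rw [← neg_div, eq_div_iff hs] <;>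
      apply mul_left_cancel₀ hs
    · linear_combination h2
    · linear_combination h3

/-- In the case `λ = ε < Λ`, for a unit vector `X = (x₁, x₂, x₃)` with `x₁ ≠ ±1` and a
unit vector `W ⊥ X`, the plane spanned by `X` and `W` has curvature `ε` if and only if
`W = ±((1−x₁²)/√(1−x₁²), −x₁x₂/√(1−x₁²), −x₁x₃/√(1−x₁²))`. -/
theorem curvature_eps_plane_extremal_minus
    {V : Type*} [NormedAddCommGroup V] [InnerProductSpace ℝ V]
    (hdim : Module.finrank ℝ V = 3)
    (R : V →ₗ[ℝ] V →ₗ[ℝ] V →ₗ[ℝ] V →ₗ[ℝ] ℝ) (hR : IsAlgCurvatureTensor R)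
    (e : Fin 3 → V) (he : Orthonormal ℝ e)
    (ε : ℝ) (hε : ε = -1 ∨ ε = 0 ∨ ε = 1)
    (hd1 : R (e 0) (e 1) (e 2) (e 0) = 0)
    (hd2 : R (e 0) (e 1) (e 1) (e 2) = 0)
    (hd3 : R (e 0) (e 2) (e 2) (e 1) = 0)
    (lam Lam : ℝ)
    (hlam : lam = R (e 0) (e 2) (e 2) (e 0))
    (hLam : Lam = R (e 1) (e 2) (e 2) (e 1))
    (h12 : R (e 0) (e 1) (e 1) (e 0) = ε)
    (horder : lam ≤ ε ∧ ε ≤ Lam)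
    (hcase : lam = ε ∧ ε < Lam)
    (x₁ x₂ x₃ : ℝ) (X : V)
    (hX : X = x₁ • e 0 + x₂ • e 1 + x₃ • e 2) (hXnorm : ‖X‖ = 1)
    (hx₁ : x₁ ≠ 1) (hx₁' : x₁ ≠ -1)
    (W : V) (hWnorm : ‖W‖ = 1) (hWX : ⟪X, W⟫ = 0) :
    R X W W X = ε ↔
      (W = ((1 - x₁ ^ 2) / Real.sqrt (1 - x₁ ^ 2)) • e 0
          + (-(x₁ * x₂) / Real.sqrt (1 - x₁ ^ 2)) • e 1
          + (-(x₁ * x₃) / Real.sqrt (1 - x₁ ^ 2)) • e 2 ∨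
       W = -(((1 - x₁ ^ 2) / Real.sqrt (1 - x₁ ^ 2)) • e 0
          + (-(x₁ * x₂) / Real.sqrt (1 - x₁ ^ 2)) • e 1
          + (-(x₁ * x₃) / Real.sqrt (1 - x₁ ^ 2)) • e 2)) := by
  have key (w₁ w₂ w₃ : ℝ) (hW : W = w₁ • e 0 + w₂ • e 1 + w₃ • e 2) :
      R X W W X = ε ↔ x₂ * w₃ - x₃ * w₂ = 0 := by
    have hx := he.inner_fin_three_s10 x₁ x₂ x₃ x₁ x₂ x₃
    have hw := he.inner_fin_three_s10 w₁ w₂ w₃ w₁ w₂ w₃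
    have hxw := he.inner_fin_three_s10 x₁ x₂ x₃ w₁ w₂ w₃
    rw [← hX, real_inner_self_eq_norm_sq, hXnorm] at hx
    rw [← hW, real_inner_self_eq_norm_sq, hWnorm] at hw
    rw [← hX, ← hW, hWX] at hxw
    have hsec : R X W W X = ε + (Lam - ε) * (x₂ * w₃ - x₃ * w₂) ^ 2 := by
      rw [hR.apply_eq_of_diagonal_s10 e hd1 hd2 hd3 x₁ x₂ x₃ w₁ w₂ w₃ hX hW, h12, ← hlam, ← hLam,
        hcase.1]
      linear_combination (-ε) * hx - ε * (x₁ * x₁ + x₂ * x₂ + x₃ * x₃) * hw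
        + ε * (x₁ * w₁ + x₂ * w₂ + x₃ * w₃) * hxw
    rw [hsec, add_eq_left, mul_eq_zero, or_iff_right (sub_pos.mpr hcase.2).ne',
      sq_eq_zero_iff]
  constructor
  · intro h
    obtain ⟨w₁, w₂, w₃, hW⟩ := he.exists_coords_fin_three hdim W
    have hx := he.inner_fin_three_s10 x₁ x₂ x₃ x₁ x₂ x₃
    have hw := he.inner_fin_three_s10 w₁ w₂ w₃ w₁ w₂ w₃
    have hxw := he.inner_fin_three_s10 x₁ x₂ x₃ w₁ w₂ w₃
    rw [← hX, real_inner_self_eq_norm_sq, hXnorm] at hx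
    rw [← hW, real_inner_self_eq_norm_sq, hWnorm] at hw
    rw [← hX, ← hW, hWX] at hxw
    have hne : 1 - x₁ ^ 2 ≠ 0 := fun h0 =>
      (mul_self_eq_one_iff.mp (by linarith : x₁ * x₁ = 1)).elim hx₁ hx₁'
    have hpos : 0 < 1 - x₁ ^ 2 := lt_of_le_of_ne (by nlinarith) hne.symm
    rcases eq_or_eq_neg_of_parallel (Real.sqrt_ne_zero'.mpr hpos) (Real.sq_sqrt hpos.le)
      (by linarith) (by linarith) hxw.symm ((key w₁ w₂ w₃ hW).mp h) with
      ⟨h1, h2, h3⟩ | ⟨h1, h2, h3⟩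
    · left
      rw [hW, h1, h2, h3]
    · right
      rw [hW, h1, h2, h3]
      module
  · rintro (hW | hW)
    · rw [key _ _ _ hW]
      ring
    · rw [neg_add, neg_add, ← neg_smul, ← neg_smul, ← neg_smul] at hW
      rw [key _ _ _ hW]
      ring
end
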